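/- Let n ≥ 3 and let f be a maximal independent broadcast on the path P_n of minimum cost (i.e. σ(f) = i_b(P_n)), with f-broadcast vertices x_{i_1}, …, x_{i_t}, i_1 < ⋯ < i_t, where t ≥ 2. Then: (1) f(x_{i_1}) ≥ f(x_{i_2}) and f(x_{i_t}) ≥ f(x_{i_{t−1}}); (2) d(x_1, x_{i_1}) ≤ f(x_{i_1}) and d(x_{i_t}, x_n) ≤ f(x_{i_t}); (3) for every j with 1 ≤ j ≤ t−1, max{f(x_{i_j}), f(x_{i_{j+1}})} + 1 ≤ d(x_{i_j}, x_{i_{j+1}}) ≤ f(x_{i_j}) + f(x_{i_{j+1}}) + 1; (4) d(x_{i_1}, x_{i_2}) = f(x_{i_1}) + 1 and d(x_{i_{t−1}}, x_{i_t}) = f(x_{i_t}) + 1. -/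

import Mathlib

open SimpleGraph

namespace Broadcast

variable {V : Type*} [Fintype V]

/-- The eccentricity of a vertex: the maximum distance from `v` to any vertex. -/
noncomputable def ecc (G : SimpleGraph V) (v : V) : ℕ :=
  Finset.univ.sup fun u => G.dist v u

/-- A broadcast on `G`: `f v ≤ e_G(v)` for every vertex `v`. -/
def IsBroadcast (G : SimpleGraph V) (f : V → ℕ) : Prop :=
  ∀ v, f v ≤ ecc G v

/-- The cost of a broadcast. -/
def cost (f : V → ℕ) : ℕ := ∑ v, f v

/-- `hears G f u` is H_f(u): the set of f-broadcast vertices `v` with `d(u,v) ≤ f v`. -/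
def hears (G : SimpleGraph V) (f : V → ℕ) (u : V) : Set V :=
  {v | 1 ≤ f v ∧ G.dist u v ≤ f v}

/-- A dominating broadcast: every vertex hears some broadcast vertex. -/
def IsDominating (G : SimpleGraph V) (f : V → ℕ) : Prop :=
  IsBroadcast G f ∧ ∀ u, (hears G f u).Nonempty

/-- A minimal dominating broadcast. -/
def IsMinimalDominating (G : SimpleGraph V) (f : V → ℕ) : Prop :=
  IsDominating G f ∧ ∀ g, IsDominating G g → (∀ v, g v ≤ f v) → g = f

/-- The broadcast domination number γ_b: minimum cost of a dominating broadcast. -/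
noncomputable def broadcastDomination (G : SimpleGraph V) : ℕ :=
  sInf {c | ∃ f, IsDominating G f ∧ cost f = c}

/-- The upper broadcast domination number Γ_b: maximum cost of a minimal dominating broadcast. -/
noncomputable def upperBroadcastDomination (G : SimpleGraph V) : ℕ :=
  sSup {c | ∃ f, IsMinimalDominating G f ∧ cost f = c}

/-- The private f-neighborhood PN_f(v): vertices hearing only `v`. -/
def privateNbhd (G : SimpleGraph V) (f : V → ℕ) (v : V) : Set V :=
  {u | hears G f u = {v}}

open Classical in
/-- The private f-border PB_f(v). -/
noncomputable def privateBorder (G : SimpleGraph V) (f : V → ℕ) (v : V) : Set V :=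
  if f v = 1 ∧ privateNbhd G f v = {v} then {v}
  else {u | u ∈ privateNbhd G f v ∧ G.dist u v = f v}

/-- An irredundant broadcast: every broadcast vertex has a nonempty private border. -/
def IsIrredundant (G : SimpleGraph V) (f : V → ℕ) : Prop :=
  IsBroadcast G f ∧ ∀ v, 1 ≤ f v → (privateBorder G f v).Nonempty

/-- A maximal irredundant broadcast. -/
def IsMaximalIrredundant (G : SimpleGraph V) (f : V → ℕ) : Prop :=
  IsIrredundant G f ∧ ∀ g, IsIrredundant G g → (∀ v, f v ≤ g v) → g = f

/-- The upper broadcast irredundance number IR_b: maximum cost of an irredundant broadcast. -/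
noncomputable def upperBroadcastIrredundance (G : SimpleGraph V) : ℕ :=
  sSup {c | ∃ f, IsIrredundant G f ∧ cost f = c}

/-- The broadcast irredundance number ir_b: minimum cost of a maximal irredundant broadcast. -/
noncomputable def broadcastIrredundance (G : SimpleGraph V) : ℕ :=
  sInf {c | ∃ f, IsMaximalIrredundant G f ∧ cost f = c}

/-- An independent broadcast: every broadcast vertex hears only itself, i.e. |H_f(v)| = 1. -/
def IsIndependent (G : SimpleGraph V) (f : V → ℕ) : Prop :=
  IsBroadcast G f ∧ ∀ v, 1 ≤ f v → hears G f v = {v}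

/-- A maximal independent broadcast. -/
def IsMaximalIndependent (G : SimpleGraph V) (f : V → ℕ) : Prop :=
  IsIndependent G f ∧ ∀ g, IsIndependent G g → (∀ v, f v ≤ g v) → g = f

/-- The broadcast independence number β_b: maximum cost of an independent broadcast. -/
noncomputable def broadcastIndependence (G : SimpleGraph V) : ℕ :=
  sSup {c | ∃ f, IsIndependent G f ∧ cost f = c}

/-- The lower broadcast independence number i_b: minimum cost of a maximal independent broadcast. -/
noncomputable def lowerBroadcastIndependence (G : SimpleGraph V) : ℕ :=
  sInf {c | ∃ f, IsMaximalIndependent G f ∧ cost f = c}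

/-- A packing broadcast: every vertex hears at most one broadcast vertex. -/
def IsPacking (G : SimpleGraph V) (f : V → ℕ) : Prop :=
  IsBroadcast G f ∧ ∀ u, (hears G f u).Subsingleton

/-- A maximal packing broadcast. -/
def IsMaximalPacking (G : SimpleGraph V) (f : V → ℕ) : Prop :=
  IsPacking G f ∧ ∀ g, IsPacking G g → (∀ v, f v ≤ g v) → g = f

/-- The broadcast packing number P_b: maximum cost of a packing broadcast. -/
noncomputable def broadcastPacking (G : SimpleGraph V) : ℕ :=
  sSup {c | ∃ f, IsPacking G f ∧ cost f = c}

/-- The lower broadcast packing number p_b: minimum cost of a maximal packing broadcast. -/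
noncomputable def lowerBroadcastPacking (G : SimpleGraph V) : ℕ :=
  sInf {c | ∃ f, IsMaximalPacking G f ∧ cost f = c}

end Broadcast

open Broadcast in
theorem path_dist_le (n : ℕ) (k : ℕ) : ∀ (u v : Fin n), u.val + k = v.val →
    (SimpleGraph.pathGraph n).dist u v ≤ k := by
  induction k with
  | zero => intro u v h; have : u = v := Fin.ext (by omega); subst this; simp
  | succ k ih =>
    intro u v h
    have hw : u.val + k < n := by have := v.isLt; omega
    have h1 := ih u ⟨u.val + k, hw⟩ rfl
    have hadj : (SimpleGraph.pathGraph n).Adj ⟨u.val + k, hw⟩ v := by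
      rw [SimpleGraph.pathGraph_adj]; left; simp; omega
    have hc : (SimpleGraph.pathGraph n).Connected := by
      obtain ⟨m, rfl⟩ : ∃ m, n = m + 1 := ⟨n - 1, by have := v.isLt; omega⟩
      exact SimpleGraph.pathGraph_connected m
    have h2 := hc.dist_triangle (u := u) (v := ⟨u.val + k, hw⟩) (w := v)
    rw [SimpleGraph.dist_eq_one_iff_adj.2 hadj] at h2
    omega

theorem path_walk_ge (n : ℕ) {u v : Fin n} (p : (SimpleGraph.pathGraph n).Walk u v) :
    u.val ≤ v.val + p.length ∧ v.val ≤ u.val + p.length := by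
  induction p with
  | nil => simp
  | cons h p ih =>
    rw [SimpleGraph.pathGraph_adj] at h
    simp only [SimpleGraph.Walk.length_cons]
    omega

theorem path_dist (n : ℕ) (u v : Fin n) :
    (SimpleGraph.pathGraph n).dist u v = (u.val - v.val) + (v.val - u.val) := by
  have hc : (SimpleGraph.pathGraph n).Connected := by
    obtain ⟨m, rfl⟩ : ∃ m, n = m + 1 := ⟨n - 1, by have := v.isLt; omega⟩
    exact SimpleGraph.pathGraph_connected m
  obtain ⟨p, hp⟩ := hc.exists_walk_length_eq_dist u v
  have h1 := path_walk_ge n p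
  rcases le_total u.val v.val with h | h
  · have := path_dist_le n (v.val - u.val) u v (by omega)
    omega
  · have := path_dist_le n (u.val - v.val) v u (by omega)
    rw [SimpleGraph.dist_comm] at this
    omega

open Broadcast in
theorem dist_le_ecc' {V : Type*} [Fintype V] (G : SimpleGraph V) (u v : V) :
    G.dist u v ≤ ecc G u :=
  Finset.le_sup (f := fun w => G.dist u w) (Finset.mem_univ v)

open Broadcast in
theorem indep_lt {V : Type*} [Fintype V] {G : SimpleGraph V} {f : V → ℕ}
    (hf : IsIndependent G f) {u v : V} (hu : 1 ≤ f u) (hv : 1 ≤ f v) (h : u ≠ v) :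
    f v < G.dist u v := by
  by_contra hc
  have : v ∈ hears G f u := ⟨hv, by omega⟩
  rw [hf.2 u hu] at this
  exact h this.symm

open Broadcast in
theorem indep_of {V : Type*} [Fintype V] {G : SimpleGraph V} {f : V → ℕ}
    (hb : IsBroadcast G f) (h : ∀ u v, 1 ≤ f u → 1 ≤ f v → u ≠ v → f v < G.dist u v) :
    IsIndependent G f := by
  refine ⟨hb, fun u hu => Set.ext fun v => ⟨fun hv => ?_, fun hv => ?_⟩⟩
  · by_contra hne
    have := h u v hu hv.1 (fun e => hne e.symm)
    have := hv.2
    omega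
  · have : v = u := hv
    subst this
    exact ⟨hu, by simp⟩

open Broadcast in
theorem no_raise {V : Type*} [Fintype V] {G : SimpleGraph V} {f : V → ℕ}
    (hf : IsMaximalIndependent G f) {v w : V} (hv : 1 ≤ f v) (hw : 1 ≤ f w) (hvw : w ≠ v)
    (h : ∀ u, 1 ≤ f u → u ≠ v → f v + 1 < G.dist u v) : False := by
  classical
  have hg : IsIndependent G (Function.update f v (f v + 1)) := by
    apply indep_of
    · intro u
      by_cases e : u = v
      · subst e
        have h1 := dist_le_ecc' G u w
        have h2 := h w hw hvw
        rw [SimpleGraph.dist_comm] at h2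
        simp; omega
      · simpa [e] using hf.1.1 u
    · intro a b ha hb hab
      by_cases eb : b = v
      · subst eb
        simp only [Function.update_self, Function.update_of_ne hab] at *
        exact h a ha hab
      · by_cases ea : a = v
        · subst ea
          simp only [Function.update_of_ne eb] at *
          exact indep_lt hf.1 hv hb hab
        · simp only [Function.update_of_ne eb, Function.update_of_ne ea] at *
          exact indep_lt hf.1 ha hb hab
  have := congrFun (hf.2 _ hg (fun u => by
    by_cases e : u = v
    · subst e; simp
    · simp [e])) v
  simp at this

open Broadcast in
theorem dominates {V : Type*} [Fintype V] {G : SimpleGraph V} {f : V → ℕ}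
    (hf : IsMaximalIndependent G f) (hne : ∀ u, 1 ≤ ecc G u) (u : V) :
    ∃ v, 1 ≤ f v ∧ G.dist u v ≤ f v := by
  classical
  by_contra! hc
  have hu : f u = 0 := by
    by_contra h0
    have := hc u (by omega)
    simp at this
  have hg : IsIndependent G (Function.update f u 1) := by
    apply indep_of
    · intro w
      by_cases e : w = u
      · subst e; simpa using hne w
      · simpa [e] using hf.1.1 w
    · intro a b ha hb hab
      by_cases eb : b = u
      · subst eb
        simp only [Function.update_self, Function.update_of_ne hab] at *
        have := hc a ha
        rw [SimpleGraph.dist_comm] at this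
        omega
      · by_cases ea : a = u
        · subst ea
          simp only [Function.update_of_ne eb] at *
          exact hc b hb
        · simp only [Function.update_of_ne eb, Function.update_of_ne ea] at *
          exact indep_lt hf.1 ha hb hab
  have := congrFun (hf.2 _ hg (fun w => by
    by_cases e : w = u
    · subst e; simp [hu]
    · simp [e])) u
  simp [hu] at this

open Broadcast in
/-- Structure of optimal maximal independent broadcasts (i_b-broadcasts) on paths:
items (1)-(4) of the lemma. Here `x j` lists the f-broadcast vertices in increasing
order (`x ⟨0,_⟩` is x_{i_1} and `x ⟨t-1,_⟩` is x_{i_t}). -/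
theorem ib_broadcast_path_structure (n : ℕ) (hn : 3 ≤ n) (f : Fin n → ℕ)
    (hf : IsMaximalIndependent (SimpleGraph.pathGraph n) f)
    (hopt : cost f = lowerBroadcastIndependence (SimpleGraph.pathGraph n))
    (t : ℕ) (ht : 2 ≤ t) (x : Fin t → Fin n) (hx : StrictMono x)
    (hrange : ∀ v : Fin n, 1 ≤ f v ↔ ∃ j, x j = v) :
    -- (1)
    (f (x ⟨1, by omega⟩) ≤ f (x ⟨0, by omega⟩) ∧
     f (x ⟨t - 2, by omega⟩) ≤ f (x ⟨t - 1, by omega⟩)) ∧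
    -- (2)
    ((SimpleGraph.pathGraph n).dist ⟨0, by omega⟩ (x ⟨0, by omega⟩) ≤ f (x ⟨0, by omega⟩) ∧
     (SimpleGraph.pathGraph n).dist (x ⟨t - 1, by omega⟩) ⟨n - 1, by omega⟩ ≤
       f (x ⟨t - 1, by omega⟩)) ∧
    -- (3)
    (∀ j : ℕ, ∀ hj : j + 1 < t,
      max (f (x ⟨j, by omega⟩)) (f (x ⟨j + 1, hj⟩)) + 1 ≤
        (SimpleGraph.pathGraph n).dist (x ⟨j, by omega⟩) (x ⟨j + 1, hj⟩) ∧
      (SimpleGraph.pathGraph n).dist (x ⟨j, by omega⟩) (x ⟨j + 1, hj⟩) ≤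
        f (x ⟨j, by omega⟩) + f (x ⟨j + 1, hj⟩) + 1) ∧
    -- (4)
    ((SimpleGraph.pathGraph n).dist (x ⟨0, by omega⟩) (x ⟨1, by omega⟩) =
       f (x ⟨0, by omega⟩) + 1 ∧
     (SimpleGraph.pathGraph n).dist (x ⟨t - 2, by omega⟩) (x ⟨t - 1, by omega⟩) =
       f (x ⟨t - 1, by omega⟩) + 1) := by
  have hpos : ∀ j, 1 ≤ f (x j) := fun j => (hrange _).2 ⟨j, rfl⟩
  have hlt : ∀ i j : Fin t, i < j → (x i).val < (x j).val := fun i j h => hx h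
  have hind : ∀ i j : Fin t, i < j →
      (x i).val + f (x i) < (x j).val ∧ (x i).val + f (x j) < (x j).val := by
    intro i j h
    have h0 := hlt i j h
    have h1 := indep_lt hf.1 (hpos i) (hpos j) (hx h).ne
    have h2 := indep_lt hf.1 (hpos j) (hpos i) (hx h).ne'
    rw [path_dist] at h1 h2
    omega
  have hdom : ∀ u : Fin n, ∃ j : Fin t,
      (u.val - (x j).val) + ((x j).val - u.val) ≤ f (x j) := by
    intro u
    obtain ⟨v, hv, hd⟩ := dominates hf (fun u => by
      by_cases e : u.val = 0
      · have := dist_le_ecc' (SimpleGraph.pathGraph n) u ⟨1, by omega⟩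
        rw [path_dist] at this; simp only at this; omega
      · have := dist_le_ecc' (SimpleGraph.pathGraph n) u ⟨0, by omega⟩
        rw [path_dist] at this; simp only at this; omega) u
    obtain ⟨j, rfl⟩ := (hrange v).1 hv
    rw [path_dist] at hd
    exact ⟨j, hd⟩
  have hmono : ∀ i j : Fin t, i ≤ j → (x i).val ≤ (x j).val := fun i j h => hx.monotone h
  have i01 := hind ⟨0, by omega⟩ ⟨1, by omega⟩ (by simp)
  have ilast := hind ⟨t - 2, by omega⟩ ⟨t - 1, by omega⟩ (by simp; omega)
  have h4a : (x ⟨1, by omega⟩).val = (x ⟨0, by omega⟩).val + f (x ⟨0, by omega⟩) + 1 := by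
    by_contra hne
    refine no_raise hf (hpos ⟨0, by omega⟩) (hpos ⟨1, by omega⟩)
      (hx (by simp)).ne' (fun u hu hu' => ?_)
    obtain ⟨j, rfl⟩ := (hrange u).1 hu
    have hj : j.val ≠ 0 := fun e => hu' (congrArg x (Fin.ext e))
    have := hmono ⟨1, by omega⟩ j (by rw [Fin.le_def]; simp only; omega)
    rw [path_dist]
    omega
  have h4b : (x ⟨t - 1, by omega⟩).val =
      (x ⟨t - 2, by omega⟩).val + f (x ⟨t - 1, by omega⟩) + 1 := by
    by_contra hne
    refine no_raise hf (hpos ⟨t - 1, by omega⟩) (hpos ⟨t - 2, by omega⟩)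
      (hx (by simp; omega)).ne (fun u hu hu' => ?_)
    obtain ⟨j, rfl⟩ := (hrange u).1 hu
    have hj : j.val ≠ t - 1 := fun e => hu' (congrArg x (Fin.ext e))
    have := hmono j ⟨t - 2, by omega⟩ (by rw [Fin.le_def]; simp only; omega)
    rw [path_dist]
    omega
  refine ⟨⟨by omega, by omega⟩, ⟨?_, ?_⟩, ?_, ?_, ?_⟩
  · obtain ⟨j, hj⟩ := hdom ⟨0, by omega⟩
    by_cases e : j = ⟨0, by omega⟩
    · rw [e] at hj; rw [path_dist]; exact hj
    · have := hind ⟨0, by omega⟩ j (by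
        rw [Fin.lt_def]; simp only
        have : j.val ≠ 0 := fun h => e (Fin.ext h)
        omega)
      simp only at hj
      omega
  · obtain ⟨j, hj⟩ := hdom ⟨n - 1, by omega⟩
    by_cases e : j = ⟨t - 1, by omega⟩
    · rw [e] at hj; rw [path_dist]; simp only at hj ⊢; omega
    · have := hind j ⟨t - 1, by omega⟩ (by
        rw [Fin.lt_def]; simp only
        have : j.val ≠ t - 1 := fun h => e (Fin.ext h)
        omega)
      have := (x ⟨t - 1, by omega⟩).isLt
      simp only at hj
      omega
  · intro j hj
    have h1 := hind ⟨j, by omega⟩ ⟨j + 1, hj⟩ (by simp)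
    rw [path_dist]
    refine ⟨by omega, ?_⟩
    by_contra hc
    obtain ⟨k, hk⟩ := hdom ⟨(x ⟨j, by omega⟩).val + f (x ⟨j, by omega⟩) + 1, by
      have := (x ⟨j + 1, hj⟩).isLt
      omega⟩
    simp only at hk
    rcases lt_trichotomy k.val j with h | h | h
    · have := hind k ⟨j, by omega⟩ h
      omega
    · have e : k = ⟨j, by omega⟩ := Fin.ext h
      rw [e] at hk
      omega
    · by_cases e : k = ⟨j + 1, hj⟩
      · subst e; omega
      · have := hind ⟨j + 1, hj⟩ k (by
          rw [Fin.lt_def]; simp only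
          have : k.val ≠ j + 1 := fun h => e (Fin.ext h)
          omega)
        omega
  · rw [path_dist]; omega
  · rw [path_dist]; omega
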